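/- Let n > 5 and let m ≥ 3 be an odd integer. Let a₀, a₁, …, a_m ∈ ℂ with a_m = 1, a₀ real and nonzero, and suppose that for each r = 1, …, m−1 and every β ∈ ℂ with β^{2mn} = 1 we have a_r ≠ (−1)^r β^{−nr} conj(a_r), where conj denotes complex conjugation. Define f(X) = a₀X^{nm} + Σ_{r=1}^m ( a_r X^{n(m+r)} + (−1)^r conj(a_r) X^{n(m−r)} ). Then there exist no α ∈ ℂ* and c ∈ ℂ* such that X^{2mn}·f(α/X) = c·f(X) as polynomials in ℂ[X]. -/

import Mathlib

open Polynomial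

theorem aux_coeff (n m : ℕ) (hn : 0 < n) (b : ℂ) (u v : ℕ → ℂ) (s : ℕ) (hs1 : 1 ≤ s)
    (hs : s ≤ m) :
    (C b * X ^ (n * m) + ∑ r ∈ Finset.Icc 1 m,
      (C (u r) * X ^ (n * (m + r)) + C (v r) * X ^ (n * (m - r)))).coeff (n * (m + s)) = u s := by
  simp only [coeff_add, finset_sum_coeff, coeff_C_mul_X_pow, Nat.mul_right_inj hn.ne']
  rw [if_neg (by omega), zero_add, Finset.sum_eq_single s]
  · rw [if_pos rfl, if_neg (by omega), add_zero]
  · intro r hr hrs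
    rw [Finset.mem_Icc] at hr
    rw [if_neg (by omega), if_neg (by omega), add_zero]
  · intro h
    exact absurd (Finset.mem_Icc.2 ⟨hs1, hs⟩) h

theorem aux_coeff0 (n m : ℕ) (hn : 0 < n) (b : ℂ) (u v : ℕ → ℂ) :
    (C b * X ^ (n * m) + ∑ r ∈ Finset.Icc 1 m,
      (C (u r) * X ^ (n * (m + r)) + C (v r) * X ^ (n * (m - r)))).coeff (n * m) = b := by
  simp only [coeff_add, finset_sum_coeff, coeff_C_mul_X_pow, Nat.mul_right_inj hn.ne']
  rw [if_pos trivial, Finset.sum_eq_zero, add_zero]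
  intro r hr
  rw [Finset.mem_Icc] at hr
  rw [if_neg (by omega), if_neg (by omega), add_zero]

/-- Let `n > 5`, `m ≥ 3` odd, and
`f(X) = a₀X^{nm} + Σ_{r=1}^m (a_r X^{n(m+r)} + (−1)^r conj(a_r) X^{n(m−r)})` with `a_m = 1`,
`a₀` real and nonzero, and suppose `a_r ≠ (−1)^r β^{−nr} conj(a_r)` for all `1 ≤ r ≤ m − 1`
and all `2mn`-th roots of unity `β`.  Then there are no `α, c ∈ ℂ*` with
`X^{2mn}·f(α/X) = c·f(X)`; here `X^{2mn}·f(α/X)` is the polynomial obtained from `f` by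
replacing each monomial `b·X^k` by `b·α^k·X^{2mn−k}`. -/
theorem no_inversion_symmetry (n m : ℕ) (hn : 5 < n) (hm : Odd m) (hm3 : 3 ≤ m)
    (a : ℕ → ℂ) (ham : a m = 1) (ha0real : (starRingEnd ℂ) (a 0) = a 0) (ha0 : a 0 ≠ 0)
    (hgen : ∀ r : ℕ, 1 ≤ r → r ≤ m - 1 → ∀ β : ℂ, β ^ (2 * m * n) = 1 →
      a r ≠ (-1) ^ r * (β ^ (n * r))⁻¹ * (starRingEnd ℂ) (a r))
    (f : Polynomial ℂ)
    (hf : f = C (a 0) * X ^ (n * m) +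
      ∑ r ∈ Finset.Icc 1 m,
        (C (a r) * X ^ (n * (m + r)) +
          C ((-1) ^ r * (starRingEnd ℂ) (a r)) * X ^ (n * (m - r)))) :
    ¬ ∃ α c : ℂ, α ≠ 0 ∧ c ≠ 0 ∧
      (C (a 0 * α ^ (n * m)) * X ^ (n * m) +
        ∑ r ∈ Finset.Icc 1 m,
          (C (a r * α ^ (n * (m + r))) * X ^ (n * (m - r)) +
            C ((-1) ^ r * (starRingEnd ℂ) (a r) * α ^ (n * (m - r))) * X ^ (n * (m + r))))
        = C c * f := by
  rintro ⟨α, c, hα, hc, h⟩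
  have hn0 : 0 < n := by omega
  simp only [add_comm (C (a _ * α ^ _) * X ^ (n * (m - _)))] at h
  have key : ∀ s, 1 ≤ s → s ≤ m →
      (-1) ^ s * (starRingEnd ℂ) (a s) * α ^ (n * (m - s)) = c * a s := by
    intro s h1 h2
    have := congrArg (fun p => p.coeff (n * (m + s))) h
    simp only [hf, coeff_C_mul] at this
    rw [aux_coeff n m hn0 _ a (fun r => (-1) ^ r * (starRingEnd ℂ) (a r)) s h1 h2,
      aux_coeff n m hn0 _ (fun r => (-1) ^ r * (starRingEnd ℂ) (a r) * α ^ (n * (m - r)))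
        (fun r => a r * α ^ (n * (m + r))) s h1 h2] at this
    exact this
  have key0 : a 0 * α ^ (n * m) = c * a 0 := by
    have := congrArg (fun p => p.coeff (n * m)) h
    simp only [hf, coeff_C_mul] at this
    rw [aux_coeff0 n m hn0 _ a (fun r => (-1) ^ r * (starRingEnd ℂ) (a r)),
      aux_coeff0 n m hn0 _ (fun r => (-1) ^ r * (starRingEnd ℂ) (a r) * α ^ (n * (m - r)))
        (fun r => a r * α ^ (n * (m + r)))] at this
    exact this
  have hcα : α ^ (n * m) = c := mul_left_cancel₀ ha0 (by rw [key0, mul_comm])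
  have hc1 : c = -1 := by
    have := key m (by omega) le_rfl
    simpa [ham, hm.neg_one_pow] using this.symm
  have h1 := key 1 le_rfl (by omega)
  refine hgen 1 le_rfl (by omega) α ?_ ?_
  · rw [show 2 * m * n = (n * m) * 2 by ring, pow_mul, hcα, hc1]
    norm_num
  · have hsplit : α ^ (n * m) = α ^ (n * (m - 1)) * α ^ n := by
      rw [← pow_add]
      congr 1
      obtain ⟨k, rfl⟩ : ∃ k, m = k + 1 := ⟨m - 1, by omega⟩
      simp [mul_add]
    rw [← hcα, hsplit] at h1
    have hp : α ^ (n * (m - 1)) ≠ 0 := pow_ne_zero _ hα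
    have hq : α ^ n ≠ 0 := pow_ne_zero _ hα
    have h2 : (-1) ^ 1 * (starRingEnd ℂ) (a 1) = α ^ n * a 1 := by
      apply mul_left_cancel₀ hp
      linear_combination h1
    rw [mul_one n, mul_right_comm, h2]
    field_simp
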